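/- Let q be a prime power, r ≥ 3, γ ∈ F̄_q with γ^{q^r} = γ^q but γ ∉ F_q, K = F_{q^s}(t) with γ, and let a ∈ K×, b = γa and λ_0 with λ_0 a^q = −ta − a^{q^r}. Then Φ^{λ_0}_{t^2}(b) = (γ−γ^q)t^2 a + (γ^q − γ^{q^2})·(−t^{q+1} a + a^{q^r}(t^{q^r} − t^q)), where Φ^λ_t(x) = tx + λ x^q + x^{q^r}. -/

import Mathlib

/-- the algebraic identity in Case 2b: with γ^{q^r} = γ^q, γ ∉ F_q,
b = γa and λ₀a^q = -ta - a^{q^r}, one has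
Φ^{λ₀}_{t²}(b) = (γ-γ^q)t²a + (γ^q-γ^{q²})(-t^{q+1}a + a^{q^r}(t^{q^r}-t^q)). -/
theorem stmt18 {L : Type*} [Field L] (p k q r s : ℕ) [Fact p.Prime] [CharP L p]
    (hk : 0 < k) (hq : q = p ^ k) (hr : 3 ≤ r) (hs : 0 < s)
    (γ : L) (hγs : γ ^ q ^ s = γ) (hγr : γ ^ q ^ r = γ ^ q) (hγq : γ ^ q ≠ γ)
    (t a : L) (ha : a ≠ 0)
    (l0 : L) (hl0 : l0 * a ^ q = -(t * a) - a ^ q ^ r)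
    (b : L) (hb : b = γ * a)
    (Φ : L → L) (hΦ : ∀ x : L, Φ x = t * x + l0 * x ^ q + x ^ q ^ r) :
    Φ (Φ b) = (γ - γ ^ q) * t ^ 2 * a +
      (γ ^ q - γ ^ q ^ 2) * (-(t ^ (q + 1) * a) + a ^ q ^ r * (t ^ q ^ r - t ^ q)) := by
  have h1 : Φ b = (γ - γ ^ q) * (t * a) := by
    rw [hΦ, hb, mul_pow, mul_pow, hγr]
    linear_combination γ ^ q * hl0
  have h2 : (γ - γ ^ q) ^ q = γ ^ q - γ ^ q ^ 2 := by
    have h : (γ - γ ^ q) ^ q = γ ^ q - (γ ^ q) ^ q := by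
      subst hq
      exact sub_pow_char_pow ..
    rw [h, ← pow_mul, ← pow_two]
  have h3 : (γ - γ ^ q) ^ q ^ r = γ ^ q - γ ^ q ^ 2 := by
    have h : (γ - γ ^ q) ^ q ^ r = γ ^ q ^ r - (γ ^ q) ^ q ^ r := by
      generalize γ ^ q = y
      rw [hq, ← pow_mul]
      exact sub_pow_char_pow ..
    rw [h, ← pow_mul, mul_comm, pow_mul, hγr, ← pow_mul, ← pow_two]
  rw [h1, hΦ]
  simp only [mul_pow, h2, h3]
  linear_combination (γ ^ q - γ ^ q ^ 2) * t ^ q * hl0
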